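/- Let 0 < p < 1 and ε ∈ (0, 1/4) be fixed. A.a.s., for every integer k with εn ≤ k < n − n^{1/4}·ln²n, writing ñ = k + 14 and considering the subgraph G_ñ of G(n,p) induced on the last ñ vertices, there are more than ε(n−k)/15 vertices of G_ñ with degree greater than ñp + √(ñp(1−p))·(√((1/2)·ln(n/(n−k))) − 1). -/

import Mathlib

open Classical Finset Filter

noncomputable def grWeight (n : ℕ) (p : ℝ) (G : SimpleGraph (Fin n)) : ℝ :=
  p ^ G.edgeFinset.card * (1 - p) ^ (n.choose 2 - G.edgeFinset.card)

noncomputable def grPr (n : ℕ) (p : ℝ) (A : Set (SimpleGraph (Fin n))) : ℝ :=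
  ∑ G : SimpleGraph (Fin n), if G ∈ A then grWeight n p G else 0

/-- The degree of `v` inside the vertex subset `S`. -/
noncomputable def degIn {n : ℕ} (G : SimpleGraph (Fin n)) (S : Finset (Fin n)) (v : Fin n) : ℕ :=
  (S.filter (fun w => G.Adj v w)).card

/-- The last `m` vertices of `Fin n`. -/
noncomputable def lastVerts (n m : ℕ) : Finset (Fin n) :=
  Finset.univ.filter (fun v : Fin n => n - m ≤ (v : ℕ))

/-- expectation over random subset -/
noncomputable def rsE {α : Type*} (p : ℝ) (E : Finset α) (f : Finset α → ℝ) : ℝ :=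
  ∑ F ∈ E.powerset, p ^ F.card * (1 - p) ^ (E.card - F.card) * f F

lemma rsE_mul {α : Type*} [DecidableEq α] (p : ℝ) (E₁ E₂ : Finset α) (h : Disjoint E₁ E₂) (f g : Finset α → ℝ) :
    rsE p (E₁ ∪ E₂) (fun F => f (F ∩ E₁) * g (F ∩ E₂)) = rsE p E₁ f * rsE p E₂ g := by
  unfold rsE
  rw [Finset.sum_mul_sum, ← Finset.sum_product']
  symm
  refine Finset.sum_nbij' (fun x => x.1 ∪ x.2) (fun F => (F ∩ E₁, F ∩ E₂)) ?_ ?_ ?_ ?_ ?_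
  · rintro ⟨a, b⟩ hx
    simp only [Finset.mem_product, Finset.mem_powerset] at hx ⊢
    exact Finset.union_subset_union hx.1 hx.2
  · intro F hF
    simp
  · rintro ⟨a, b⟩ hx
    simp only [Finset.mem_product, Finset.mem_powerset] at hx
    rw [Finset.disjoint_left] at h
    ext x
    · have := @hx.1 x; have := @hx.2 x; have := @h x; simp; tauto
    · have := @hx.1 x; have := @hx.2 x; have := @h x; simp; tauto
  · intro F hF
    simp only [Finset.mem_powerset] at hF
    rw [← Finset.inter_union_distrib_left, Finset.inter_eq_left.2 hF]
  · rintro ⟨a, b⟩ hx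
    simp only [Finset.mem_product, Finset.mem_powerset] at hx
    have hab : Disjoint a b := Finset.disjoint_of_subset_left hx.1 (Finset.disjoint_of_subset_right hx.2 h)
    have e1 : (a ∪ b) ∩ E₁ = a := by
      rw [Finset.disjoint_left] at h
      ext x; have := @hx.1 x; have := @hx.2 x; have := @h x; simp; tauto
    have e2 : (a ∪ b) ∩ E₂ = b := by
      rw [Finset.disjoint_left] at h
      ext x; have := @hx.1 x; have := @hx.2 x; have := @h x; simp; tauto
    have h1 := Finset.card_le_card hx.1
    have h2 := Finset.card_le_card hx.2
    simp only [e1, e2]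
    rw [Finset.card_union_of_disjoint hab, Finset.card_union_of_disjoint h,
      show E₁.card + E₂.card - (a.card + b.card) = (E₁.card - a.card) + (E₂.card - b.card) by omega,
      pow_add, pow_add]
    ring

lemma rsE_one {α : Type*} (p : ℝ) (E : Finset α) : rsE p E (fun _ => 1) = 1 := by
  unfold rsE
  have := Finset.sum_pow_mul_eq_add_pow p (1 - p) E
  simp only [mul_one]
  rw [this]; simp

lemma rsE_congr {α : Type*} (p : ℝ) (E : Finset α) (f g : Finset α → ℝ)
    (h : ∀ F ⊆ E, f F = g F) : rsE p E f = rsE p E g := by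
  unfold rsE
  refine Finset.sum_congr rfl fun F hF => ?_
  rw [h F (Finset.mem_powerset.1 hF)]

lemma rsE_sub {α : Type*} [DecidableEq α] (p : ℝ) (E E₁ : Finset α) (h : E₁ ⊆ E) (f : Finset α → ℝ) :
    rsE p E (fun F => f (F ∩ E₁)) = rsE p E₁ f := by
  have := rsE_mul p E₁ (E \ E₁) Finset.disjoint_sdiff f (fun _ => 1)
  rw [rsE_one, mul_one, Finset.union_sdiff_of_subset h] at this
  simpa using this

lemma rsE_biUnion {α ι : Type*} [DecidableEq α] [DecidableEq ι] (p : ℝ) (A : Finset ι) (E : ι → Finset α)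
    (h : ∀ v ∈ A, ∀ w ∈ A, v ≠ w → Disjoint (E v) (E w)) (f : ι → Finset α → ℝ) :
    rsE p (A.biUnion E) (fun F => ∏ v ∈ A, f v (F ∩ E v)) = ∏ v ∈ A, rsE p (E v) (f v) := by
  induction A using Finset.induction_on with
  | empty => simp [rsE]
  | insert a A ha ih =>
    rw [Finset.prod_insert ha, ← ih (fun v hv w hw => h v (by simp [hv]) w (by simp [hw])),
      ← rsE_mul, Finset.biUnion_insert]
    · refine rsE_congr _ _ _ _ fun F hF => ?_
      rw [Finset.prod_insert ha]
      congr 1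
      refine Finset.prod_congr rfl fun v hv => ?_
      congr 1
      ext x; simp; tauto
    · rw [Finset.disjoint_biUnion_right]
      intro i hi
      exact h a (by simp) i (by simp [hi]) (by rintro rfl; exact ha hi)

lemma rsE_card {α : Type*} (p : ℝ) (E : Finset α) (f : ℕ → ℝ) :
    rsE p E (fun F => f F.card) =
      ∑ j ∈ Finset.range (E.card + 1), (E.card.choose j : ℝ) * p ^ j * (1 - p) ^ (E.card - j) * f j := by
  unfold rsE
  rw [Finset.sum_powerset_apply_card (fun j => p ^ j * (1 - p) ^ (E.card - j) * f j)]
  simp [mul_assoc]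

lemma gr_eq_rsE (n : ℕ) (p : ℝ) (f : Finset (Sym2 (Fin n)) → ℝ) :
    ∑ G : SimpleGraph (Fin n), grWeight n p G * f G.edgeFinset =
      rsE p (⊤ : SimpleGraph (Fin n)).edgeFinset f := by
  unfold rsE grWeight
  refine Finset.sum_bij (fun G _ => G.edgeFinset) ?_ ?_ ?_ ?_
  · intro G _
    simp only [Finset.mem_powerset]
    exact SimpleGraph.edgeFinset_subset_edgeFinset.2 le_top
  · intro G _ H _ h
    exact SimpleGraph.edgeFinset_inj.1 h
  · intro F hF
    simp only [Finset.mem_powerset] at hF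
    refine ⟨SimpleGraph.fromEdgeSet (F : Set (Sym2 (Fin n))), Finset.mem_univ _, ?_⟩
    ext e
    simp only [SimpleGraph.mem_edgeFinset, SimpleGraph.edgeSet_fromEdgeSet]
    constructor
    · intro h; exact h.1
    · intro h
      refine ⟨h, ?_⟩
      have := hF h
      simpa using this
  · intro G _
    rw [SimpleGraph.card_edgeFinset_top_eq_card_choose_two]
    simp

lemma grWeight_nonneg (n : ℕ) (p : ℝ) (hp0 : 0 < p) (hp1 : p < 1) (G : SimpleGraph (Fin n)) :
    0 ≤ grWeight n p G := by
  unfold grWeight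
  have : 0 < 1 - p := by linarith
  positivity

lemma grWeight_sum (n : ℕ) (p : ℝ) : ∑ G : SimpleGraph (Fin n), grWeight n p G = 1 := by
  have := gr_eq_rsE n p (fun _ => 1)
  simpa [rsE_one] using this

lemma block_exp (n : ℕ) (p : ℝ) (A B : Finset (Fin n)) (h : Disjoint A B) (T θ : ℝ) :
    ∑ G : SimpleGraph (Fin n), grWeight n p G *
      Real.exp (-θ * ((A.filter (fun v => T < (degIn G B v : ℝ))).card : ℝ)) =
    (∑ j ∈ Finset.range (B.card + 1), (B.card.choose j : ℝ) * p ^ j * (1 - p) ^ (B.card - j) *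
      (if T < j then Real.exp (-θ) else 1)) ^ A.card := by
  set E : Fin n → Finset (Sym2 (Fin n)) := fun v => B.image (fun w => s(v, w)) with hE
  have hdisj : ∀ v ∈ A, ∀ w ∈ A, v ≠ w → Disjoint (E v) (E w) := by
    intro v hv w hw hvw
    rw [Finset.disjoint_left] at h ⊢
    intro e he he'
    simp only [hE, Finset.mem_image] at he he'
    obtain ⟨a, ha, rfl⟩ := he
    obtain ⟨b, hb, hab⟩ := he'
    rw [Sym2.eq_iff] at hab
    rcases hab with ⟨h1, h2⟩ | ⟨h1, h2⟩
    · exact hvw h1.symm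
    · exact h hw (h1 ▸ ha)
  have hcard : ∀ v, (E v).card = B.card := by
    intro v
    refine Finset.card_image_of_injective _ ?_
    intro a b hab
    exact (Sym2.congr_right).1 hab
  have hdeg : ∀ (G : SimpleGraph (Fin n)) (v), degIn G B v = (G.edgeFinset ∩ E v).card := by
    intro G v
    unfold degIn
    symm
    rw [← Finset.card_image_of_injective (B.filter (fun w => G.Adj v w)) (f := fun w => s(v, w))
      (by intro a b hab; exact (Sym2.congr_right).1 hab)]
    congr 1
    ext e
    simp only [hE, Finset.mem_inter, SimpleGraph.mem_edgeFinset, Finset.mem_image, Finset.mem_filter]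
    constructor
    · rintro ⟨h1, w, hw, rfl⟩
      exact ⟨w, ⟨hw, by simpa using h1⟩, rfl⟩
    · rintro ⟨w, ⟨hw, h1⟩, rfl⟩
      exact ⟨by simpa using h1, w, hw, rfl⟩
  have hsub : A.biUnion E ⊆ (⊤ : SimpleGraph (Fin n)).edgeFinset := by
    intro e he
    simp only [hE, Finset.mem_biUnion, Finset.mem_image] at he
    obtain ⟨v, hv, w, hw, rfl⟩ := he
    rw [SimpleGraph.mem_edgeFinset, SimpleGraph.mem_edgeSet, SimpleGraph.top_adj]
    rintro rfl
    exact Finset.disjoint_left.1 h hv hw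
  set φ : ℕ → ℝ := fun j => if T < j then Real.exp (-θ) else 1 with hφ
  have key : ∀ G : SimpleGraph (Fin n),
      Real.exp (-θ * ((A.filter (fun v => T < (degIn G B v : ℝ))).card : ℝ)) =
      ∏ v ∈ A, φ (G.edgeFinset ∩ A.biUnion E ∩ E v).card := by
    intro G
    have : ∀ v ∈ A, φ (G.edgeFinset ∩ A.biUnion E ∩ E v).card =
        if T < (degIn G B v : ℝ) then Real.exp (-θ) else 1 := by
      intro v hv
      rw [Finset.inter_assoc, Finset.inter_eq_right.2 (Finset.subset_biUnion_of_mem E hv), ← hdeg]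
    rw [Finset.prod_congr rfl this, Finset.prod_ite]
    simp [← Real.exp_nat_mul]
    ring_nf
  simp only [key]
  rw [gr_eq_rsE n p (fun F => ∏ v ∈ A, φ (F ∩ A.biUnion E ∩ E v).card),
    rsE_sub p _ _ hsub (fun F => ∏ v ∈ A, φ (F ∩ E v).card),
    rsE_biUnion p A E hdisj (fun v F => φ F.card)]
  rw [Finset.prod_congr rfl (fun v _ => rsE_card p (E v) φ)]
  simp only [hcard]
  rw [Finset.prod_const]

noncomputable def bpm (M : ℕ) (p : ℝ) (j : ℕ) : ℝ := (M.choose j : ℝ) * p ^ j * (1 - p) ^ (M - j)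

lemma bpm_nonneg (M : ℕ) (p : ℝ) (hp0 : 0 < p) (hp1 : p < 1) (j : ℕ) : 0 ≤ bpm M p j := by
  unfold bpm
  have : 0 < 1 - p := by linarith
  positivity

lemma bpm_sum (M : ℕ) (p : ℝ) : ∑ j ∈ Finset.range (M + 1), bpm M p j = 1 := by
  have := congrArg (Polynomial.eval p) (bernsteinPolynomial.sum ℝ M)
  rw [Polynomial.eval_finsetSum] at this
  simpa [bernsteinPolynomial, bpm] using this

lemma bpm_var (M : ℕ) (p : ℝ) :
    ∑ j ∈ Finset.range (M + 1), ((j : ℝ) - M * p) ^ 2 * bpm M p j = M * p * (1 - p) := by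
  have := congrArg (Polynomial.eval p) (bernsteinPolynomial.variance ℝ M)
  rw [Polynomial.eval_finsetSum] at this
  simp [bernsteinPolynomial] at this
  rw [← this]
  refine Finset.sum_congr rfl fun j _ => ?_
  unfold bpm
  ring

lemma bpm_succ (M : ℕ) (p : ℝ) (i : ℕ) (h : i < M) :
    bpm M p (i + 1) * ((i + 1) * (1 - p)) = bpm M p i * ((M - i) * p) := by
  unfold bpm
  have h1 := Nat.choose_succ_right_eq M i
  have h2 : (M.choose (i + 1) : ℝ) * (i + 1) = M.choose i * (M - i) := by
    have := congrArg (Nat.cast (R := ℝ)) h1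
    rw [Nat.cast_mul, Nat.cast_mul, Nat.cast_sub h.le] at this
    push_cast at this
    exact this
  rw [show M - i = (M - (i + 1)) + 1 by omega, pow_succ, pow_succ]
  linear_combination (p ^ i * p * (1 - p) ^ (M - (i + 1)) * (1 - p)) * h2

lemma bpm_point (M : ℕ) (p : ℝ) (hp0 : 0 < p) (hp1 : p < 1) (V : ℝ) (hV : V = M * p * (1 - p))
    (hV0 : 0 < V) (j : ℕ) (hjM : j ≤ M) (hj : M * p ≤ j) (hu : ((j : ℝ) - M * p + 1) ≤ 0.04 * V) :
    3 / 4 ≤ (4 * √V + 1) * (bpm M p j * Real.exp (1.05 * ((j : ℝ) - M * p + 1) ^ 2 / (2 * V))) := by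
  have hq : 0 < 1 - p := by linarith
  set ψ : ℕ → ℝ := fun i => bpm M p i * Real.exp (1.05 * (max ((i : ℝ) - M * p + 1) 0) ^ 2 / (2 * V))
    with hψ
  have hψj : ψ j = bpm M p j * Real.exp (1.05 * ((j : ℝ) - M * p + 1) ^ 2 / (2 * V)) := by
    simp only [hψ]
    rw [max_eq_left (by linarith)]
  rw [← hψj]
  have step : ∀ i < j, ψ i ≤ ψ (i + 1) := by
    intro i hi
    have hs := bpm_succ M p i (by omega)
    have hb0 := bpm_nonneg M p hp0 hp1 i
    have hb1 := bpm_nonneg M p hp0 hp1 (i + 1)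
    have hden : (0 : ℝ) < (i + 1) * (1 - p) := by positivity
    simp only [hψ]
    push_cast
    rcases le_total ((i : ℝ) - M * p + 1) 0 with hd | hd
    · have : bpm M p i ≤ bpm M p (i + 1) := by
        by_contra hc
        push Not at hc
        have h1 : ((i : ℝ) + 1) * (1 - p) ≤ (M - i) * p := by nlinarith
        have h2 := mul_lt_mul_of_pos_right hc hden
        rw [hs] at h2
        have := mul_le_mul_of_nonneg_left h1 hb0
        linarith
      have hm : max ((i : ℝ) - M * p + 1) 0 ≤ max ((i : ℝ) + 1 - M * p + 1) 0 :=
        max_le_max (by linarith) le_rfl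
      have := le_max_right ((i : ℝ) - M * p + 1) 0
      gcongr
    · rw [max_eq_left hd, max_eq_left (by linarith)]
      set D := (i : ℝ) - M * p + 1 with hD
      have hi' : (i : ℝ) + 1 ≤ j := by exact_mod_cast hi
      have hu0 : 0 ≤ D / V := by positivity
      have hu1 : D / V ≤ 0.04 := by
        rw [div_le_iff₀ hV0]; linarith
      have hb : bpm M p i * (1 - D / V) ≤ bpm M p (i + 1) := by
        by_contra hc
        push Not at hc
        have h2 := mul_lt_mul_of_pos_right hc hden
        rw [hs] at h2
        have h1 : (1 - D / V) * ((i + 1) * (1 - p)) ≤ (M - i) * p := by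
          have e1 : ((i : ℝ) + 1) * (1 - p) = V + D * (1 - p) := by rw [hV, hD]; ring
          have e2 : ((M : ℝ) - i) * p = V - D * p + p := by rw [hV, hD]; ring
          rw [e1, e2]
          have e3 : (1 - D / V) * (V + D * (1 - p)) = V + D * (1 - p) - D - D / V * (D * (1 - p)) := by
            field_simp
            ring
          rw [e3]
          have : 0 ≤ D / V * (D * (1 - p)) := by positivity
          linarith
        have := mul_le_mul_of_nonneg_left h1 hb0
        linarith
      have hexp : Real.exp (1.05 * D ^ 2 / (2 * V)) * Real.exp (1.05 * (D / V)) ≤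
          Real.exp (1.05 * ((i : ℝ) + 1 - M * p + 1) ^ 2 / (2 * V)) := by
        rw [← Real.exp_add, show (i : ℝ) + 1 - M * p + 1 = D + 1 by rw [hD]; ring]
        apply Real.exp_le_exp.2
        have : 1.05 * (D + 1) ^ 2 / (2 * V) = 1.05 * D ^ 2 / (2 * V) + 1.05 * (D / V) + 1.05 / (2 * V) := by
          field_simp; ring
        rw [this]
        have : 0 ≤ 1.05 / (2 * V) := by positivity
        linarith
      have hone : 1 ≤ (1 - D / V) * Real.exp (1.05 * (D / V)) := by
        have h1 := Real.add_one_le_exp (1.05 * (D / V))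
        have h2 : (1 - D / V) * (1.05 * (D / V) + 1) ≤ (1 - D / V) * Real.exp (1.05 * (D / V)) :=
          mul_le_mul_of_nonneg_left h1 (by linarith)
        nlinarith
      calc bpm M p i * Real.exp (1.05 * D ^ 2 / (2 * V))
          ≤ (bpm M p i * Real.exp (1.05 * D ^ 2 / (2 * V))) * ((1 - D / V) * Real.exp (1.05 * (D / V))) :=
            le_mul_of_one_le_right (by positivity) hone
        _ = (bpm M p i * (1 - D / V)) * (Real.exp (1.05 * D ^ 2 / (2 * V)) * Real.exp (1.05 * (D / V))) := by ring
        _ ≤ _ := mul_le_mul hb hexp (by positivity) hb1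
  have hle : ∀ t, t ≤ j → ψ (j - t) ≤ ψ j := by
    intro t
    induction t with
    | zero => intro _; simp
    | succ t ih =>
      intro ht
      have := step (j - (t + 1)) (by omega)
      rw [show j - (t + 1) + 1 = j - t by omega] at this
      exact this.trans (ih (by omega))
  have hbψ : ∀ i, bpm M p i ≤ ψ i := by
    intro i
    refine le_mul_of_one_le_right (bpm_nonneg M p hp0 hp1 i) (Real.one_le_exp ?_)
    positivity
  have hge : ∀ t, j + t ≤ M → bpm M p (j + t) ≤ bpm M p j := by
    intro t
    induction t with
    | zero => intro _; simp
    | succ t ih =>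
      intro ht
      refine le_trans ?_ (ih (by omega))
      have hs := bpm_succ M p (j + t) (by omega)
      by_contra hc
      push Not at hc
      have hden : (0 : ℝ) < ((j + t : ℕ) + 1) * (1 - p) := by positivity
      have h2 := mul_lt_mul_of_pos_right hc hden
      rw [← add_assoc, hs] at h2
      have h1 : ((M : ℝ) - (j + t : ℕ)) * p ≤ ((j + t : ℕ) + 1) * (1 - p) := by
        push_cast
        have : (0 : ℝ) ≤ t := by positivity
        nlinarith
      have := mul_le_mul_of_nonneg_left h1 (bpm_nonneg M p hp0 hp1 (j + t))
      linarith
  have hall : ∀ i ∈ Finset.range (M + 1), bpm M p i ≤ ψ j := by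
    intro i hi
    rw [Finset.mem_range] at hi
    rcases le_total i j with h | h
    · have := hle (j - i) (by omega)
      rw [show j - (j - i) = i by omega] at this
      exact (hbψ i).trans this
    · have := hge (i - j) (by omega)
      rw [show j + (i - j) = i by omega] at this
      exact this.trans (hbψ j)
  have hψ0 : 0 ≤ ψ j := (bpm_nonneg M p hp0 hp1 j).trans (hbψ j)
  -- Chebyshev
  set σ := √V with hσ
  have hσ2 : σ ^ 2 = V := Real.sq_sqrt hV0.le
  have hσ0 : 0 < σ := Real.sqrt_pos.2 hV0
  set W := (Finset.range (M + 1)).filter (fun i : ℕ => |(i : ℝ) - M * p| ≤ 2 * σ) with hW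
  have hsum : ∑ i ∈ Finset.range (M + 1), bpm M p i ≤
      ∑ i ∈ W, bpm M p i + 1 / (4 * V) * ∑ i ∈ Finset.range (M + 1), ((i : ℝ) - M * p) ^ 2 * bpm M p i := by
    rw [hW, Finset.sum_filter, Finset.mul_sum, ← Finset.sum_add_distrib]
    refine Finset.sum_le_sum fun i _ => ?_
    have hb0 := bpm_nonneg M p hp0 hp1 i
    split_ifs with h
    · have : 0 ≤ 1 / (4 * V) * (((i : ℝ) - M * p) ^ 2 * bpm M p i) := by positivity
      linarith
    · push Not at h
      have h4 : 4 * V ≤ ((i : ℝ) - M * p) ^ 2 := by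
        rw [← sq_abs, ← hσ2]; nlinarith
      have : 1 ≤ 1 / (4 * V) * ((i : ℝ) - M * p) ^ 2 := by
        rw [one_div_mul_eq_div, le_div_iff₀ (by positivity)]; linarith
      nlinarith
  rw [bpm_sum, bpm_var, ← hV] at hsum
  have h14 : 1 / (4 * V) * V = 1 / 4 := by field_simp
  rw [h14] at hsum
  have hWs : ∑ i ∈ W, bpm M p i ≤ W.card * ψ j := by
    rw [← nsmul_eq_mul]
    exact Finset.sum_le_card_nsmul _ _ _ fun i hi => hall i (Finset.mem_filter.1 hi).1
  have hWc : (W.card : ℝ) ≤ 4 * σ + 1 := by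
    have hsub : W ⊆ Finset.Icc ⌈(M : ℝ) * p - 2 * σ⌉₊ ⌊(M : ℝ) * p + 2 * σ⌋₊ := by
      intro i hi
      have := (Finset.mem_filter.1 hi).2
      rw [abs_le] at this
      rw [Finset.mem_Icc]
      exact ⟨Nat.ceil_le.2 (by linarith), Nat.le_floor (by linarith)⟩
    have h1 := Finset.card_le_card hsub
    rw [Nat.card_Icc] at h1
    have h2 := Nat.le_ceil ((M : ℝ) * p - 2 * σ)
    have h3 := Nat.floor_le (show 0 ≤ (M : ℝ) * p + 2 * σ by positivity)
    rcases le_total ⌈(M : ℝ) * p - 2 * σ⌉₊ (⌊(M : ℝ) * p + 2 * σ⌋₊ + 1) with h | h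
    · have h4 : (W.card : ℝ) ≤ ((⌊(M : ℝ) * p + 2 * σ⌋₊ + 1 - ⌈(M : ℝ) * p - 2 * σ⌉₊ : ℕ) : ℝ) := by exact_mod_cast h1
      rw [Nat.cast_sub h] at h4
      push_cast at h4
      linarith
    · have : W.card = 0 := by omega
      rw [this]; push_cast; linarith
  have := mul_le_mul_of_nonneg_right hWc hψ0
  linarith

lemma bpm_tail (M : ℕ) (p : ℝ) (hp0 : 0 < p) (hp1 : p < 1) (V : ℝ) (hV : V = M * p * (1 - p))
    (hV0 : 1000000 ≤ V) (T y : ℝ) (hy : 0 ≤ y) (hT : T ≤ M * p + y * √V)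
    (hyV : y + 1 + 0.001 ≤ 0.04 * √V) :
    0.186 * Real.exp (-(1.05 * (y + 1 + 0.001) ^ 2 / 2)) ≤
      ∑ j ∈ Finset.range (M + 1), if T < j then bpm M p j else 0 := by
  have hσ2 : √V ^ 2 = V := Real.sq_sqrt (by linarith)
  have hσ : 1000 ≤ √V := by
    apply Real.le_sqrt_of_sq_le; linarith
  set σ := √V with hσd
  set T' := M * p + y * σ with hT'
  have hT'0 : 0 ≤ T' := by positivity
  set J := Finset.Ioc ⌊T'⌋₊ ⌊T' + σ⌋₊ with hJ
  have hJm : ∀ j ∈ J, T' < j ∧ (j : ℝ) ≤ T' + σ := by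
    intro j hj
    rw [hJ, Finset.mem_Ioc] at hj
    exact ⟨(Nat.floor_lt hT'0).1 hj.1, (Nat.le_floor_iff (by positivity)).1 hj.2⟩
  have hM : T' + σ ≤ M := by
    have h1 : (y + 1) * σ ≤ 0.04 * V := by
      rw [← hσ2]; nlinarith
    have h2 : V ≤ M * (1 - p) := by
      rw [hV]
      have : (0 : ℝ) ≤ M * (1 - p) := mul_nonneg (by positivity) (by linarith)
      nlinarith
    rw [hT']
    nlinarith
  have hpt : ∀ j ∈ J, 3 / 4 / (4 * σ + 1) * Real.exp (-(1.05 * (y + 1 + 0.001) ^ 2 / 2)) ≤ bpm M p j := by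
    intro j hj
    obtain ⟨h1, h2⟩ := hJm j hj
    have hys : 0 ≤ y * σ := by positivity
    have hmu : (M : ℝ) * p ≤ j := by linarith
    have hbd : (j : ℝ) - M * p + 1 ≤ (y + 1 + 0.001) * σ := by
      rw [hT'] at h2; nlinarith
    have hb := bpm_point M p hp0 hp1 V hV (by linarith) j (by exact_mod_cast h2.trans hM) hmu
      (by rw [← hσ2]; nlinarith)
    have hexp : 1.05 * ((j : ℝ) - M * p + 1) ^ 2 / (2 * V) ≤ 1.05 * (y + 1 + 0.001) ^ 2 / 2 := by
      rw [div_le_div_iff₀ (by linarith) (by norm_num)]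
      have : ((j : ℝ) - M * p + 1) ^ 2 ≤ ((y + 1 + 0.001) * σ) ^ 2 :=
        pow_le_pow_left₀ (by linarith) hbd 2
      rw [mul_pow, hσ2] at this
      nlinarith
    have hb0 := bpm_nonneg M p hp0 hp1 j
    rw [Real.exp_neg, ← div_eq_mul_inv, div_le_iff₀ (Real.exp_pos _), div_le_iff₀ (by positivity)]
    refine hb.trans ?_
    rw [mul_comm]
    gcongr
  have hcard : σ - 1 ≤ J.card := by
    rw [hJ, Nat.card_Ioc]
    have h1 := Nat.floor_le hT'0
    have h2 := Nat.lt_floor_add_one (T' + σ)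
    have h3 : ⌊T'⌋₊ ≤ ⌊T' + σ⌋₊ := Nat.floor_le_floor (by linarith)
    rw [Nat.cast_sub h3]
    linarith
  have hJs : J ⊆ (Finset.range (M + 1)).filter (fun j : ℕ => T < j) := by
    intro j hj
    obtain ⟨h1, h2⟩ := hJm j hj
    rw [Finset.mem_filter, Finset.mem_range]
    have : j ≤ M := by exact_mod_cast h2.trans hM
    exact ⟨by omega, by linarith⟩
  rw [← Finset.sum_filter]
  refine le_trans ?_ (Finset.sum_le_sum_of_subset_of_nonneg hJs fun j _ _ => bpm_nonneg M p hp0 hp1 j)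
  have hs := Finset.card_nsmul_le_sum J _ _ hpt
  rw [nsmul_eq_mul] at hs
  refine le_trans ?_ hs
  have hc : 0.186 ≤ (J.card : ℝ) * (3 / 4 / (4 * σ + 1)) := by
    rw [← mul_div_assoc, le_div_iff₀ (by positivity)]
    linarith
  rw [← mul_assoc]
  exact mul_le_mul_of_nonneg_right hc (Real.exp_pos _).le

/-- numeric consequence -/
lemma tail_num (x : ℝ) (hx : 0 ≤ x) :
    0.1 * Real.exp (-x ^ 2) ≤
      0.186 * Real.exp (-(1.05 * (1.01 * max x 1 + 0.001) ^ 2 / 2)) := by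
  set X := max x 1 with hX
  have hX1 : 1 ≤ X := le_max_right _ _
  have h1 : 1.05 * (1.01 * X + 0.001) ^ 2 / 2 ≤ 0.54 * X ^ 2 := by nlinarith
  have h2 : 0.54 * X ^ 2 ≤ x ^ 2 + 0.54 := by
    rcases le_total x 1 with h | h
    · rw [hX, max_eq_right h]; nlinarith
    · rw [hX, max_eq_left h]; nlinarith
  have h3 : Real.exp (-x ^ 2) * Real.exp (-0.54) ≤ Real.exp (-(1.05 * (1.01 * X + 0.001) ^ 2 / 2)) := by
    rw [← Real.exp_add]; apply Real.exp_le_exp.2; linarith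
  have h4 : (0.1 : ℝ) / 0.186 ≤ Real.exp (-0.54) := by
    have h5 : Real.exp (0.54 : ℝ) ≤ 1.86 := by
      have := Real.exp_bound' (x := 0.54) (by norm_num) (by norm_num) (n := 4) (by norm_num)
      refine this.trans ?_
      norm_num [Finset.sum_range_succ, Nat.factorial]
    rw [Real.exp_neg, div_le_iff₀ (by norm_num)]
    have := Real.exp_pos (0.54 : ℝ)
    rw [inv_mul_eq_div, le_div_iff₀ this]
    linarith
  have h6 := mul_le_mul_of_nonneg_left h4 (Real.exp_pos (-x ^ 2)).le
  have h7 : Real.exp (-x ^ 2) * (0.1 / 0.186) * 0.186 = 0.1 * Real.exp (-x ^ 2) := by ring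
  nlinarith

lemma block_fail (n : ℕ) (p : ℝ) (hp0 : 0 < p) (hp1 : p < 1) (A B : Finset (Fin n))
    (h : Disjoint A B) (T P₀ : ℝ) (hP0 : 0 ≤ P₀)
    (hP : P₀ ≤ ∑ j ∈ Finset.range (B.card + 1), if T < j then bpm B.card p j else 0) :
    ∑ G : SimpleGraph (Fin n),
      (if ((A.filter (fun v => T < (degIn G B v : ℝ))).card : ℝ) ≤ 0.9 * A.card * P₀
        then grWeight n p G else 0) ≤ Real.exp (-0.005 * (A.card * P₀)) := by
  have h1 : ∑ G : SimpleGraph (Fin n),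
      (if ((A.filter (fun v => T < (degIn G B v : ℝ))).card : ℝ) ≤ 0.9 * A.card * P₀
        then grWeight n p G else 0) ≤
      ∑ G : SimpleGraph (Fin n), Real.exp (0.1 * (0.9 * A.card * P₀)) * (grWeight n p G *
      Real.exp (-0.1 * ((A.filter (fun v => T < (degIn G B v : ℝ))).card : ℝ))) := by
    refine Finset.sum_le_sum fun G _ => ?_
    have hw := grWeight_nonneg n p hp0 hp1 G
    split_ifs with hc
    · rw [mul_left_comm, ← Real.exp_add]
      refine le_mul_of_one_le_right hw (Real.one_le_exp ?_)
      linarith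
    · positivity
  refine h1.trans ?_
  rw [← Finset.mul_sum, block_exp n p A B h T 0.1]
  set Q := ∑ j ∈ Finset.range (B.card + 1), (B.card.choose j : ℝ) * p ^ j * (1 - p) ^ (B.card - j) *
      (if T < j then Real.exp (-0.1) else 1) with hQ
  have hQ0 : 0 ≤ Q := by
    refine Finset.sum_nonneg fun j _ => mul_nonneg (bpm_nonneg B.card p hp0 hp1 j) ?_
    split_ifs <;> positivity
  have he : Real.exp (-0.1) ≤ 0.905 := by
    have := Real.quadratic_le_exp_of_nonneg (x := 0.1) (by norm_num)
    rw [Real.exp_neg, inv_le_comm₀ (Real.exp_pos _) (by norm_num)]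
    refine le_trans ?_ this
    norm_num
  have hQe : Q = 1 - (1 - Real.exp (-0.1)) *
      ∑ j ∈ Finset.range (B.card + 1), if T < j then bpm B.card p j else 0 := by
    rw [eq_sub_iff_add_eq, hQ, Finset.mul_sum, ← Finset.sum_add_distrib]
    refine Eq.trans ?_ (bpm_sum B.card p)
    refine Finset.sum_congr rfl fun j _ => ?_
    split_ifs
    · unfold bpm; ring
    · unfold bpm; ring
  have hQ1 : Q ≤ Real.exp (-0.095 * P₀) := by
    have h2 : 0.095 * P₀ ≤ (1 - Real.exp (-0.1)) *
      ∑ j ∈ Finset.range (B.card + 1), if T < j then bpm B.card p j else 0 := by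
      apply mul_le_mul _ hP hP0 _ <;> linarith
    have := Real.add_one_le_exp (-0.095 * P₀)
    linarith
  calc _ ≤ Real.exp (0.1 * (0.9 * A.card * P₀)) * Real.exp (-0.095 * P₀) ^ A.card := by gcongr
    _ = _ := by
      rw [← Real.exp_nat_mul, ← Real.exp_add]; congr 1; ring

lemma exists_blocks {α : Type*} [DecidableEq α] (S : Finset α) (s : ℕ) (L : ℕ) (h : L * s ≤ S.card) :
    ∃ A : ℕ → Finset α, (∀ i < L, A i ⊆ S ∧ (A i).card = s) ∧
      ∀ i < L, ∀ j < L, i ≠ j → Disjoint (A i) (A j) := by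
  induction L generalizing S with
  | zero => exact ⟨fun _ => ∅, by simp, by simp⟩
  | succ L ih =>
    rw [Nat.succ_mul] at h
    obtain ⟨U, hU, hUc⟩ := Finset.exists_subset_card_eq (show s ≤ S.card by omega)
    obtain ⟨A, hA, hd⟩ := ih (S \ U) (by rw [Finset.card_sdiff_of_subset hU]; omega)
    have hAU : ∀ i < L, Disjoint (A i) U := fun i hi =>
      Finset.disjoint_of_subset_left (hA i hi).1 Finset.sdiff_disjoint
    refine ⟨fun i => if i = L then U else A i, ?_, ?_⟩
    · intro i hi
      by_cases hL : i = L
      · simp [hL, hU, hUc]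
      · simp only [hL, if_false]
        have := hA i (by omega)
        exact ⟨this.1.trans Finset.sdiff_subset, this.2⟩
    · intro i hi j hj hij
      by_cases h1 : i = L <;> by_cases h2 : j = L
      · omega
      · simp only [h1, h2, if_true, if_false]; exact (hAU j (by omega)).symm
      · simp only [h1, h2, if_true, if_false]; exact hAU i (by omega)
      · simp only [h1, h2, if_false]; exact hd i (by omega) j (by omega) hij

lemma k_fail (n s : ℕ) (p : ℝ) (hp0 : 0 < p) (hp1 : p < 1) (S : Finset (Fin n)) (T P₀ τ : ℝ)
    (hs : 0 < s) (hsm : s ≤ S.card) (hP0 : 0 ≤ P₀)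
    (hP : P₀ ≤ ∑ j ∈ Finset.range (S.card - s + 1), if T < j then bpm (S.card - s) p j else 0)
    (hτ : τ ≤ (S.card / s : ℕ) * (0.9 * s * P₀)) :
    ∑ G : SimpleGraph (Fin n),
      (if τ < ((S.filter (fun v => T < (degIn G S v : ℝ))).card : ℝ) then 0 else grWeight n p G) ≤
      S.card * Real.exp (-0.005 * (s * P₀)) := by
  set L := S.card / s with hL
  have hL0 : 0 < L := Nat.div_pos hsm hs
  obtain ⟨A, hA, hd⟩ := exists_blocks S s L (Nat.div_mul_le_self _ _)
  set c : SimpleGraph (Fin n) → ℕ → ℕ := fun G i =>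
    ((A i).filter (fun v => T < (degIn G (S \ A i) v : ℝ))).card with hc
  have hcount : ∀ G : SimpleGraph (Fin n), ∑ i ∈ Finset.range L, c G i ≤
      (S.filter (fun v => T < (degIn G S v : ℝ))).card := by
    intro G
    rw [← Finset.card_biUnion]
    · refine Finset.card_le_card ?_
      intro v hv
      simp only [Finset.mem_biUnion, Finset.mem_range, Finset.mem_filter] at hv
      obtain ⟨i, hi, hv, hT⟩ := hv
      rw [Finset.mem_filter]
      refine ⟨(hA i hi).1 hv, hT.trans_le ?_⟩
      unfold degIn
      exact_mod_cast Finset.card_le_card (Finset.filter_subset_filter _ Finset.sdiff_subset)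
    · intro i hi j hj hij
      exact Finset.disjoint_filter_filter (hd i (Finset.mem_range.1 hi) j (Finset.mem_range.1 hj) hij)
  have hstep : ∀ G : SimpleGraph (Fin n),
      (if τ < ((S.filter (fun v => T < (degIn G S v : ℝ))).card : ℝ) then 0 else grWeight n p G) ≤
      ∑ i ∈ Finset.range L, if (c G i : ℝ) ≤ 0.9 * (A i).card * P₀ then grWeight n p G else 0 := by
    intro G
    have hw := grWeight_nonneg n p hp0 hp1 G
    have hnn : ∀ i ∈ Finset.range L,
        0 ≤ if (c G i : ℝ) ≤ 0.9 * (A i).card * P₀ then grWeight n p G else 0 := by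
      intro i _; split_ifs <;> simp [hw]
    split_ifs with hg
    · exact Finset.sum_nonneg hnn
    · by_cases hex : ∃ i ∈ Finset.range L, (c G i : ℝ) ≤ 0.9 * (A i).card * P₀
      · obtain ⟨i, hi, hci⟩ := hex
        have := Finset.single_le_sum hnn hi
        rwa [if_pos hci] at this
      · exfalso
        push Not at hex
        apply hg
        have h1 : ∑ i ∈ Finset.range L, (0.9 * s * P₀) < ∑ i ∈ Finset.range L, (c G i : ℝ) := by
          refine Finset.sum_lt_sum_of_nonempty ⟨0, Finset.mem_range.2 hL0⟩ fun i hi => ?_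
          have := hex i hi
          rwa [(hA i (Finset.mem_range.1 hi)).2] at this
        rw [Finset.sum_const, Finset.card_range, nsmul_eq_mul] at h1
        have h2 : (∑ i ∈ Finset.range L, (c G i : ℝ)) ≤
          ((S.filter (fun v => T < (degIn G S v : ℝ))).card : ℝ) := by exact_mod_cast hcount G
        linarith
  refine (Finset.sum_le_sum fun G _ => hstep G).trans ?_
  rw [Finset.sum_comm]
  have hb : ∀ i ∈ Finset.range L, ∑ G : SimpleGraph (Fin n),
      (if (c G i : ℝ) ≤ 0.9 * (A i).card * P₀ then grWeight n p G else 0) ≤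
      Real.exp (-0.005 * (s * P₀)) := by
    intro i hi
    obtain ⟨hAS, hAc⟩ := hA i (Finset.mem_range.1 hi)
    have hcB : (S \ A i).card = S.card - s := by rw [Finset.card_sdiff_of_subset hAS, hAc]
    have := block_fail n p hp0 hp1 (A i) (S \ A i) Finset.disjoint_sdiff T P₀ hP0 (by rw [hcB]; exact hP)
    rw [hAc] at this ⊢
    exact this
  refine (Finset.sum_le_card_nsmul _ _ _ hb).trans ?_
  rw [Finset.card_range, nsmul_eq_mul]
  have : (L : ℝ) ≤ S.card := by exact_mod_cast Nat.div_le_self _ _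
  gcongr

lemma lastVerts_card (n m : ℕ) (h : m ≤ n) : (lastVerts n m).card = m := by
  unfold lastVerts
  have h1 := Finset.card_map (Fin.valEmbedding (n := n)) (s := Finset.univ.filter (fun v : Fin n => n - m ≤ (v : ℕ)))
  rw [← h1]
  have : (Finset.univ.filter (fun v : Fin n => n - m ≤ (v : ℕ))).map Fin.valEmbedding = Finset.Ico (n - m) n := by
    ext x
    simp only [Finset.mem_map, Finset.mem_filter, Finset.mem_univ, true_and, Finset.mem_Ico,
      Fin.valEmbedding_apply]
    constructor
    · rintro ⟨a, ha, rfl⟩; exact ⟨ha, a.2⟩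
    · rintro ⟨ha, hb⟩; exact ⟨⟨x, hb⟩, ha, rfl⟩
  rw [this, Nat.card_Ico]; omega

lemma num_tail (n m s : ℕ) (p : ℝ) (hp0 : 0 < p) (hp1 : p < 1) (ε x : ℝ) (hε0 : 0 < ε)
    (hm : ε * n ≤ m) (hsm : s ≤ m) (hx0 : 0 ≤ x)
    (h1 : 1000000 ≤ ε * p * (1 - p) / 2 * n) (h2 : (s : ℝ) ≤ 0.01 * √(ε * p * (1 - p) / 2 * n))
    (h2' : (s : ℝ) ≤ 0.01 * (ε * n)) (h3 : x ^ 2 + 1 ≤ 0.0009 * (ε * p * (1 - p) / 2 * n)) :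
    0.1 * Real.exp (-x ^ 2) ≤ ∑ j ∈ Finset.range (m - s + 1),
      if (m : ℝ) * p + √(m * p * (1 - p)) * (x - 1) < j then bpm (m - s) p j else 0 := by
  have hq : 0 < 1 - p := by linarith
  have hpq : 0 < p * (1 - p) := by positivity
  set V := ((m - s : ℕ) : ℝ) * p * (1 - p) with hV
  have hM : ((m - s : ℕ) : ℝ) = m - s := Nat.cast_sub hsm
  have hM1 : ε * n / 2 ≤ ((m - s : ℕ) : ℝ) := by rw [hM]; nlinarith
  have hVC : ε * p * (1 - p) / 2 * n ≤ V := by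
    have := mul_le_mul_of_nonneg_right hM1 hpq.le
    rw [hV]; linarith
  set σ := √V with hσ
  have hV1 : 1000000 ≤ V := h1.trans hVC
  have hσ2 : σ ^ 2 = V := Real.sq_sqrt (by linarith)
  have hσ1 : 1000 ≤ σ := by apply Real.le_sqrt_of_sq_le; linarith
  have hsσ : (s : ℝ) ≤ 0.01 * σ := h2.trans (mul_le_mul_of_nonneg_left (Real.sqrt_le_sqrt hVC) (by norm_num))
  set X := max x 1 with hX
  have hX1 : 1 ≤ X := le_max_right _ _
  have hxX : x ≤ X := le_max_left _ _
  have hXs : X ^ 2 ≤ x ^ 2 + 1 := by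
    rcases le_total x 1 with h | h
    · rw [hX, max_eq_right h]; nlinarith
    · rw [hX, max_eq_left h]; nlinarith
  have hXσ : X ≤ 0.03 * σ := by
    apply (pow_le_pow_iff_left₀ (by linarith) (by positivity) two_ne_zero).1
    rw [mul_pow, hσ2]; linarith
  have hsq : √(m * p * (1 - p)) ≤ 1.01 * σ := by
    apply Real.sqrt_le_iff.2
    refine ⟨by positivity, ?_⟩
    rw [mul_pow, hσ2, hV, hM]
    have : (m : ℝ) ≤ 1.01 ^ 2 * (m - s) := by nlinarith
    have := mul_le_mul_of_nonneg_right this hpq.le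
    linarith
  have key := bpm_tail (m - s) p hp0 hp1 V hV hV1
    ((m : ℝ) * p + √(m * p * (1 - p)) * (x - 1)) (1.01 * X - 1) (by linarith) (by
      have a1 : √(m * p * (1 - p)) * (x - 1) ≤ √(m * p * (1 - p)) * (X - 1) := by gcongr
      have a2 : √(m * p * (1 - p)) * (X - 1) ≤ 1.01 * σ * (X - 1) :=
        mul_le_mul_of_nonneg_right hsq (by linarith)
      have a3 : (s : ℝ) * p ≤ s := mul_le_of_le_one_right (by positivity) hp1.le
      rw [hM]
      nlinarith) (by rw [← hσ]; linarith)
  refine le_trans (tail_num x hx0) ?_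
  rw [show 1.01 * X - 1 + 1 + 0.001 = 1.01 * X + 0.001 by ring] at key
  exact key

lemma ev_conds (C ε : ℝ) (hC : 0 < C) (hε : 0 < ε) : ∀ᶠ n : ℕ in atTop,
    1000000 ≤ C * n ∧ (n : ℝ) ^ ((2 : ℝ) / 5) ≤ 0.01 * √(C * n) ∧
    (n : ℝ) ^ ((2 : ℝ) / 5) ≤ 0.01 * (ε * n) ∧ 1 + Real.log n ≤ 0.0009 * (C * n) ∧
    14 ≤ Real.log n ∧ 2 ≤ (n : ℝ) ^ ((2 : ℝ) / 5) := by
  have hn : Tendsto (fun n : ℕ => (n : ℝ)) atTop atTop := tendsto_natCast_atTop_atTop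
  refine hn.eventually (p := fun x : ℝ => 1000000 ≤ C * x ∧ x ^ ((2 : ℝ) / 5) ≤ 0.01 * √(C * x) ∧
    x ^ ((2 : ℝ) / 5) ≤ 0.01 * (ε * x) ∧ 1 + Real.log x ≤ 0.0009 * (C * x) ∧
    14 ≤ Real.log x ∧ 2 ≤ x ^ ((2 : ℝ) / 5)) ?_
  have e1 := (tendsto_id.const_mul_atTop hC).eventually_ge_atTop (1000000 : ℝ)
  have e5 := Real.tendsto_log_atTop.eventually_ge_atTop (14 : ℝ)
  have e6 := (tendsto_rpow_atTop (show (0 : ℝ) < 2 / 5 by norm_num)).eventually_ge_atTop (2 : ℝ)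
  have e4 := Real.isLittleO_log_id_atTop.bound (show 0 < 0.0009 * C / 2 by positivity)
  have e4' := (tendsto_id.const_mul_atTop (show 0 < 0.0009 * C / 2 by positivity)).eventually_ge_atTop (1 : ℝ)
  have e3 := (tendsto_rpow_atTop (show (0 : ℝ) < 3 / 5 by norm_num)).eventually_ge_atTop (1 / (0.01 * ε))
  have e2 := (tendsto_rpow_atTop (show (0 : ℝ) < 1 / 10 by norm_num)).eventually_ge_atTop (1 / (0.01 * √C))
  filter_upwards [e1, e2, e3, e4, e4', e5, e6, eventually_gt_atTop 0] with x a1 a2 a3 a4 a4' a5 a6 hx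
  simp only [id, Real.norm_eq_abs] at *
  refine ⟨a1, ?_, ?_, ?_, a5, a6⟩
  · rw [Real.sqrt_mul hC.le, Real.sqrt_eq_rpow x, show (1 : ℝ) / 2 = 2 / 5 + 1 / 10 by norm_num,
      Real.rpow_add hx]
    rw [div_le_iff₀ (by positivity)] at a2
    have h0 : 0 ≤ x ^ ((2 : ℝ) / 5) := by positivity
    have := mul_le_mul_of_nonneg_left a2 h0
    linarith
  · rw [div_le_iff₀ (by positivity)] at a3
    have h0 : 0 ≤ x ^ ((2 : ℝ) / 5) := by positivity
    have h1 := mul_le_mul_of_nonneg_left a3 h0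
    have h2 : x = x ^ ((2 : ℝ) / 5) * x ^ ((3 : ℝ) / 5) := by
      rw [← Real.rpow_add hx]; norm_num
    have h3 : 0.01 * (ε * x) = x ^ ((2 : ℝ) / 5) * (x ^ ((3 : ℝ) / 5) * (0.01 * ε)) := by
      nth_rewrite 1 [h2]; ring
    linarith
  · rw [abs_of_pos hx] at a4
    have := le_abs_self (Real.log x)
    linarith

lemma lim_fail : Tendsto (fun n : ℕ => (n : ℝ) ^ 2 * Real.exp (-0.00025 * (n : ℝ) ^ ((1 : ℝ) / 40)))
    atTop (nhds 0) := by
  have hn : Tendsto (fun n : ℕ => (n : ℝ) ^ ((1 : ℝ) / 40)) atTop atTop :=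
    (tendsto_rpow_atTop (by norm_num)).comp tendsto_natCast_atTop_atTop
  have h := (tendsto_rpow_mul_exp_neg_mul_atTop_nhds_zero 80 0.00025 (by norm_num)).comp hn
  refine h.congr fun n => ?_
  simp only [Function.comp]
  rw [← Real.rpow_mul (by positivity), ← Real.rpow_natCast]
  norm_num

lemma tau_bound (m s : ℕ) (hs0 : 0 < s) (a ε N e n : ℝ) (ha : a = ε * n) (hm : a ≤ m)
    (hsm : (s : ℝ) ≤ 0.01 * m) (ha0 : 0 ≤ a) (he : 0 ≤ e) (hε : 0 ≤ ε) (heN : N ≤ e * n) :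
    ε * N / 15 ≤ (m / s : ℕ) * (0.9 * s * (0.1 * e)) := by
  have h1 : (m : ℝ) - s ≤ (m / s : ℕ) * s := by
    have h2 := Nat.div_add_mod m s
    have h3 := Nat.mod_lt m hs0
    have h4 : m ≤ (m / s) * s + s := by
      rw [mul_comm (m / s)]; omega
    have h5 : (m : ℝ) ≤ (m / s : ℕ) * s + s := by exact_mod_cast h4
    linarith
  generalize ((m / s : ℕ) : ℝ) = L at *
  have h6 : 0.95 * a ≤ L * s := by linarith
  have h7 : 0.95 * a * e ≤ L * s * e := by gcongr
  have h8 : ε * N ≤ ε * (e * n) := by gcongr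
  have h9 : ε * (e * n) = a * e := by rw [ha]; ring
  have h10 : 0 ≤ a * e := by positivity
  have h11 : L * (0.9 * s * (0.1 * e)) = 0.09 * (L * s * e) := by ring
  rw [h11]
  linarith

set_option maxHeartbeats 1000000 in
lemma n_fail (p : ℝ) (hp0 : 0 < p) (hp1 : p < 1) (ε : ℝ) (hε0 : 0 < ε) (n k : ℕ)
    (c1 : 1000000 ≤ ε * p * (1 - p) / 2 * n)
    (c2 : (n : ℝ) ^ ((2 : ℝ) / 5) ≤ 0.01 * √(ε * p * (1 - p) / 2 * n))
    (c3 : (n : ℝ) ^ ((2 : ℝ) / 5) ≤ 0.01 * (ε * n))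
    (c4 : 1 + Real.log n ≤ 0.0009 * (ε * p * (1 - p) / 2 * n))
    (c5 : 14 ≤ Real.log n) (c6 : 2 ≤ (n : ℝ) ^ ((2 : ℝ) / 5))
    (hk1 : ε * n ≤ k) (hk2 : (k : ℝ) < (n : ℝ) - (n : ℝ) ^ ((1 : ℝ) / 4) * (Real.log n) ^ 2) :
    ∑ G : SimpleGraph (Fin n), (if ε * ((n : ℝ) - k) / 15 <
            (((lastVerts n (k + 14)).filter (fun v =>
              ((k + 14 : ℕ) : ℝ) * p +
                  Real.sqrt (((k + 14 : ℕ) : ℝ) * p * (1 - p)) *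
                    (Real.sqrt ((1 / 2) * Real.log ((n : ℝ) / ((n : ℝ) - k))) - 1)
                < (degIn G (lastVerts n (k + 14)) v : ℝ))).card : ℝ) then 0 else grWeight n p G) ≤
      n * Real.exp (-0.00025 * (n : ℝ) ^ ((1 : ℝ) / 40)) := by
  have hn0 : 0 < n := by
    rcases Nat.eq_zero_or_pos n with h | h
    · subst h; norm_num at c1
    · exact h
  have hnR : (1 : ℝ) ≤ n := by exact_mod_cast hn0
  have hn4 : 1 ≤ (n : ℝ) ^ ((1 : ℝ) / 4) := Real.one_le_rpow hnR (by norm_num)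
  set N := (n : ℝ) - k with hN
  have hN4 : (n : ℝ) ^ ((1 : ℝ) / 4) * 14 ^ 2 ≤ N := by
    have : (n : ℝ) ^ ((1 : ℝ) / 4) * 14 ^ 2 ≤ (n : ℝ) ^ ((1 : ℝ) / 4) * (Real.log n) ^ 2 := by gcongr
    linarith
  have hN1 : 196 ≤ N := by linarith
  have hNn : N ≤ n := by
    have : (0 : ℝ) ≤ k := by positivity
    linarith
  set m := k + 14 with hm
  have hmn : m ≤ n := by
    have : (m : ℝ) ≤ n := by rw [hm]; push_cast; linarith
    exact_mod_cast this
  have hmk : (k : ℝ) ≤ m := by rw [hm]; push_cast; linarith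
  have hmε : ε * n ≤ m := hk1.trans hmk
  set s := ⌊(n : ℝ) ^ ((2 : ℝ) / 5)⌋₊ with hs
  have hs1 : (s : ℝ) ≤ (n : ℝ) ^ ((2 : ℝ) / 5) := Nat.floor_le (by positivity)
  have hs2 : (n : ℝ) ^ ((2 : ℝ) / 5) / 2 ≤ s := by
    have := Nat.lt_floor_add_one ((n : ℝ) ^ ((2 : ℝ) / 5))
    rw [← hs] at this
    linarith
  have hs0 : 0 < s := by
    have : (0 : ℝ) < s := by linarith
    exact_mod_cast this
  have hεn : 0 ≤ ε * n := by positivity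
  have hsm' : (s : ℝ) ≤ 0.01 * m := by linarith
  have hsm : s ≤ m := by
    have : (s : ℝ) ≤ m := by nlinarith
    exact_mod_cast this
  set x := Real.sqrt ((1 / 2) * Real.log ((n : ℝ) / N)) with hx
  have hlog0 : 0 ≤ Real.log ((n : ℝ) / N) := by
    apply Real.log_nonneg
    rw [le_div_iff₀ (by linarith)]; linarith
  have hx2 : x ^ 2 = (1 / 2) * Real.log ((n : ℝ) / N) := Real.sq_sqrt (by positivity)
  have hlog1 : Real.log ((n : ℝ) / N) ≤ Real.log n := by
    apply Real.log_le_log (by apply div_pos <;> linarith)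
    exact div_le_self (by linarith) (by linarith)
  set e := Real.exp (-x ^ 2) with he
  have he0 : 0 < e := Real.exp_pos _
  have he2 : e ^ 2 = N / n := by
    rw [he, ← Real.exp_nat_mul, hx2]
    push_cast
    rw [show (2 : ℝ) * -((1 / 2) * Real.log ((n : ℝ) / N)) = -Real.log ((n : ℝ) / N) by ring,
      Real.exp_neg, Real.exp_log (by apply div_pos <;> linarith), inv_div]
  have he1 : e ≤ 1 := by
    rw [he, Real.exp_le_one_iff]
    nlinarith [sq_nonneg x]
  have heN : N ≤ e * n := by
    have h1 : e ^ 2 ≤ e := by nlinarith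
    rw [he2, div_le_iff₀ (by linarith)] at h1
    exact h1
  have hen : (n : ℝ) ^ (-(3 : ℝ) / 8) ≤ e := by
    apply (pow_le_pow_iff_left₀ (by positivity) he0.le two_ne_zero).1
    rw [he2, ← Real.rpow_natCast, ← Real.rpow_mul (by positivity), le_div_iff₀ (by linarith)]
    nth_rewrite 2 [← Real.rpow_one (n : ℝ)]
    rw [← Real.rpow_add (by linarith)]
    norm_num at hN4 ⊢
    linarith
  have hcard := lastVerts_card n m hmn
  have hP := num_tail n m s p hp0 hp1 ε x hε0 hmε hsm (Real.sqrt_nonneg _) c1 (hs1.trans c2)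
    (hs1.trans c3) (by rw [hx2]; linarith)
  have key := k_fail n s p hp0 hp1 (lastVerts n m) ((m : ℝ) * p + √(m * p * (1 - p)) * (x - 1))
    (0.1 * e) (ε * N / 15) hs0 (by rw [hcard]; exact hsm) (by positivity) (by rw [hcard]; exact hP)
    (by
      rw [hcard]
      exact tau_bound m s hs0 (ε * n) ε N e n rfl hmε hsm' hεn he0.le hε0.le heN)
  refine key.trans ?_
  rw [hcard]
  have hmn' : (m : ℝ) ≤ n := by exact_mod_cast hmn
  have h40 : (n : ℝ) ^ ((1 : ℝ) / 40) ≤ 2 * (s * e) := by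
    have h1 : (n : ℝ) ^ ((1 : ℝ) / 40) = (n : ℝ) ^ ((2 : ℝ) / 5) * (n : ℝ) ^ (-(3 : ℝ) / 8) := by
      rw [← Real.rpow_add (by linarith)]; norm_num
    rw [h1]
    have : (n : ℝ) ^ ((2 : ℝ) / 5) / 2 * (n : ℝ) ^ (-(3 : ℝ) / 8) ≤ s * e := by gcongr
    linarith
  exact mul_le_mul hmn' (Real.exp_le_exp.2 (by linarith)) (Real.exp_pos _).le (by linarith)

/-- Claim 1: a.a.s., for every `k` with `εn ≤ k < n − n^{1/4}ln²n`, writing `ñ = k+14`, the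
subgraph induced on the last `ñ` vertices has more than `ε(n−k)/15` vertices of degree greater
than `ñp + √(ñp(1−p))·(√((1/2)ln(n/(n−k))) − 1)`. -/
theorem aas_many_large_degrees (p : ℝ) (hp0 : 0 < p) (hp1 : p < 1)
    (ε : ℝ) (hε0 : 0 < ε) (hε : ε < 1 / 4) :
    Tendsto (fun n : ℕ =>
        grPr n p {G | ∀ k : ℕ, ε * n ≤ k →
          (k : ℝ) < (n : ℝ) - (n : ℝ) ^ ((1 : ℝ) / 4) * (Real.log n) ^ 2 →
          ε * ((n : ℝ) - k) / 15 <
            (((lastVerts n (k + 14)).filter (fun v =>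
              ((k + 14 : ℕ) : ℝ) * p +
                  Real.sqrt (((k + 14 : ℕ) : ℝ) * p * (1 - p)) *
                    (Real.sqrt ((1 / 2) * Real.log ((n : ℝ) / ((n : ℝ) - k))) - 1)
                < (degIn G (lastVerts n (k + 14)) v : ℝ))).card : ℝ)})
      atTop (nhds 1) := by
  have hq : 0 < 1 - p := by linarith
  have hC : 0 < ε * p * (1 - p) / 2 := by positivity
  have hlim : Tendsto (fun n : ℕ => 1 - (n : ℝ) ^ 2 * Real.exp (-0.00025 * (n : ℝ) ^ ((1 : ℝ) / 40)))
      atTop (nhds 1) := by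
    simpa using lim_fail.const_sub 1
  refine tendsto_of_tendsto_of_tendsto_of_le_of_le' hlim tendsto_const_nhds ?_ ?_
  · filter_upwards [ev_conds _ ε hC hε0] with n hn
    obtain ⟨c1, c2, c3, c4, c5, c6⟩ := hn
    unfold grPr
    rw [sub_le_iff_le_add]
    refine (grWeight_sum n p).ge.trans ?_
    set Bad : ℕ → SimpleGraph (Fin n) → Prop := fun k G => ε * n ≤ k ∧
          (k : ℝ) < (n : ℝ) - (n : ℝ) ^ ((1 : ℝ) / 4) * (Real.log n) ^ 2 ∧
          ¬ ε * ((n : ℝ) - k) / 15 <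
            (((lastVerts n (k + 14)).filter (fun v =>
              ((k + 14 : ℕ) : ℝ) * p +
                  Real.sqrt (((k + 14 : ℕ) : ℝ) * p * (1 - p)) *
                    (Real.sqrt ((1 / 2) * Real.log ((n : ℝ) / ((n : ℝ) - k))) - 1)
                < (degIn G (lastVerts n (k + 14)) v : ℝ))).card : ℝ) with hBad
    have hb : ∑ G : SimpleGraph (Fin n), ∑ k ∈ Finset.range n, (if Bad k G then grWeight n p G else 0) ≤
        (n : ℝ) ^ 2 * Real.exp (-0.00025 * (n : ℝ) ^ ((1 : ℝ) / 40)) := by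
      rw [Finset.sum_comm]
      have : ∀ k ∈ Finset.range n, ∑ G : SimpleGraph (Fin n), (if Bad k G then grWeight n p G else 0) ≤
          n * Real.exp (-0.00025 * (n : ℝ) ^ ((1 : ℝ) / 40)) := by
        intro k _
        by_cases hk : ε * n ≤ k ∧ (k : ℝ) < (n : ℝ) - (n : ℝ) ^ ((1 : ℝ) / 4) * (Real.log n) ^ 2
        · refine le_trans (le_of_eq ?_) (n_fail p hp0 hp1 ε hε0 n k c1 c2 c3 c4 c5 c6 hk.1 hk.2)
          refine Finset.sum_congr rfl fun G _ => ?_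
          simp only [hBad, hk.1, hk.2, true_and, ite_not]
        · have : ∀ G, ¬ Bad k G := fun G h => hk ⟨h.1, h.2.1⟩
          simp only [this, if_false, Finset.sum_const_zero]
          positivity
      refine (Finset.sum_le_card_nsmul _ _ _ this).trans (le_of_eq ?_)
      rw [Finset.card_range, nsmul_eq_mul]; ring
    refine le_trans ?_ (add_le_add le_rfl hb)
    rw [← Finset.sum_add_distrib]
    refine Finset.sum_le_sum fun G _ => ?_
    have hw := grWeight_nonneg n p hp0 hp1 G
    have hnn : ∀ k ∈ Finset.range n, 0 ≤ (if Bad k G then grWeight n p G else 0) := by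
      intro k _; split_ifs <;> simp [hw]
    split_ifs with hG
    · have := Finset.sum_nonneg hnn
      linarith
    · rw [Set.mem_ofPred_eq] at hG
      push Not at hG
      obtain ⟨k, k1, k2, k3⟩ := hG
      have hkn : k ∈ Finset.range n := by
        rw [Finset.mem_range]
        have : 0 ≤ (n : ℝ) ^ ((1 : ℝ) / 4) * (Real.log n) ^ 2 := by positivity
        have : (k : ℝ) < n := by linarith
        exact_mod_cast this
      have hB : Bad k G := ⟨k1, k2, not_lt.2 k3⟩
      have := Finset.single_le_sum hnn hkn
      rw [if_pos hB] at this
      linarith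
  · refine Eventually.of_forall fun n => ?_
    unfold grPr
    refine le_trans ?_ (grWeight_sum n p).le
    refine Finset.sum_le_sum fun G _ => ?_
    have hw := grWeight_nonneg n p hp0 hp1 G
    split_ifs <;> simp [hw]
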